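/- Let f(z) = exp(−2z²/z₀²) with z₀ > 0. There exists a constant D > 0 such that every C¹ function z : [0,T] → ℝ satisfying z'(t) = F_z(t, z(t)) for all t ∈ [0,T] and z(0) = z(T) satisfies max_{t ∈ [0,T]} |z(t)| ≤ D. -/

import Mathlib

open Filter Set

/-- The force `F_z(t,z) = −k F₀ f(z) sin(2kz − bt) + F₀ cos²(kz − bt/2) f'(z)`. -/
noncomputable def Fz (F₀ k b : ℝ) (f : ℝ → ℝ) (t z : ℝ) : ℝ :=
  -k * F₀ * f z * Real.sin (2 * k * z - b * t)
    + F₀ * (Real.cos (k * z - b * t / 2)) ^ 2 * deriv f z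

/-- Derivative of the Gaussian profile. -/
theorem hasDerivAt_gaussian (z₀ x : ℝ) :
    HasDerivAt (fun w : ℝ => Real.exp (-2 * w ^ 2 / z₀ ^ 2))
      (-4 * x / z₀ ^ 2 * Real.exp (-2 * x ^ 2 / z₀ ^ 2)) x := by
  have h := ((((hasDerivAt_id x).pow 2).const_mul (-2)).div_const (z₀ ^ 2)).exp
  refine h.congr_deriv ?_
  simp only [id, Pi.pow_apply]
  push_cast
  ring

/-- The Gaussian times `1 + x²` is bounded. -/
theorem gaussian_mul_one_add_sq_le {z₀ : ℝ} (hz₀ : 0 < z₀) (x : ℝ) :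
    Real.exp (-2 * x ^ 2 / z₀ ^ 2) * (1 + x ^ 2) ≤ 1 + z₀ ^ 2 / 2 := by
  have h1 : 2 * x ^ 2 / z₀ ^ 2 + 1 ≤ Real.exp (2 * x ^ 2 / z₀ ^ 2) := Real.add_one_le_exp _
  have h2 : Real.exp (-2 * x ^ 2 / z₀ ^ 2) = (Real.exp (2 * x ^ 2 / z₀ ^ 2))⁻¹ := by
    rw [← Real.exp_neg]
    congr 1
    ring
  rw [h2, inv_mul_le_iff₀ (Real.exp_pos _)]
  have h3 : 1 + x ^ 2 ≤ (2 * x ^ 2 / z₀ ^ 2 + 1) * (1 + z₀ ^ 2 / 2) := by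
    have h4 : (2 * x ^ 2 / z₀ ^ 2 + 1) * (1 + z₀ ^ 2 / 2)
        = 1 + x ^ 2 + 2 * x ^ 2 / z₀ ^ 2 + z₀ ^ 2 / 2 := by
      field_simp
      ring
    rw [h4]
    have : 0 ≤ 2 * x ^ 2 / z₀ ^ 2 := by positivity
    have : 0 ≤ z₀ ^ 2 / 2 := by positivity
    linarith
  exact h3.trans (mul_le_mul_of_nonneg_right h1 (by positivity))

/-- The force of a Gaussian profile, factored through the profile and the phase `2kz - bt`. -/
theorem Fz_gaussian (F₀ k b z₀ t x : ℝ) :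
    Fz F₀ k b (fun w => Real.exp (-2 * w ^ 2 / z₀ ^ 2)) t x =
      Real.exp (-2 * x ^ 2 / z₀ ^ 2) *
        (-(k * F₀ * Real.sin (2 * k * x - b * t))
          - 2 * F₀ / z₀ ^ 2 * x * (1 + Real.cos (2 * k * x - b * t))) := by
  have h : Real.cos (2 * k * x - b * t) = 2 * Real.cos (k * x - b * t / 2) ^ 2 - 1 := by
    rw [← Real.cos_two_mul]
    congr 1
    ring
  rw [Fz, (hasDerivAt_gaussian z₀ x).deriv, h]
  ring

/-- The force of a Gaussian profile decays at least like `1 / |z|`. -/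
theorem abs_Fz_gaussian_le {F₀ k z₀ : ℝ} (hF₀ : 0 < F₀) (hk : 0 < k) (hz₀ : 0 < z₀)
    (b t x : ℝ) :
    |Fz F₀ k b (fun w => Real.exp (-2 * w ^ 2 / z₀ ^ 2)) t x| * (1 + |x|) ≤
      2 * (k * F₀ + 4 * F₀ / z₀ ^ 2) * (1 + z₀ ^ 2 / 2) := by
  set A := 2 * F₀ / z₀ ^ 2 with hA
  have hA0 : 0 < A := by positivity
  have hkF : 0 < k * F₀ := by positivity
  have hE := Real.exp_pos (-2 * x ^ 2 / z₀ ^ 2)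
  have hx := abs_nonneg x
  have hbr : |(-(k * F₀ * Real.sin (2 * k * x - b * t))
      - A * x * (1 + Real.cos (2 * k * x - b * t)))| ≤ (k * F₀ + 2 * A) * (1 + |x|) := by
    have hs := Real.abs_sin_le_one (2 * k * x - b * t)
    have hc : |1 + Real.cos (2 * k * x - b * t)| ≤ 2 := by
      rw [abs_le]
      constructor <;>
        linarith [Real.neg_one_le_cos (2 * k * x - b * t), Real.cos_le_one (2 * k * x - b * t)]
    refine (abs_sub _ _).trans ?_
    rw [abs_neg, abs_mul (k * F₀), abs_mul (A * x), abs_mul A, abs_of_pos hkF, abs_of_pos hA0]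
    have h1 := mul_le_mul_of_nonneg_left hs hkF.le
    have h2 := mul_le_mul_of_nonneg_left hc (mul_nonneg hA0.le hx)
    nlinarith [mul_nonneg hkF.le hx]
  have hsq : (1 + |x|) * (1 + |x|) ≤ 2 * (1 + x ^ 2) := by
    nlinarith [sq_nonneg (1 - |x|), sq_abs x]
  rw [Fz_gaussian, abs_mul, abs_of_pos hE]
  calc _ ≤ Real.exp (-2 * x ^ 2 / z₀ ^ 2) * ((k * F₀ + 2 * A) * (1 + |x|)) * (1 + |x|) := by
        gcongr
    _ = (k * F₀ + 2 * A) * (Real.exp (-2 * x ^ 2 / z₀ ^ 2) * ((1 + |x|) * (1 + |x|))) := by ring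
    _ ≤ (k * F₀ + 2 * A) * (Real.exp (-2 * x ^ 2 / z₀ ^ 2) * (2 * (1 + x ^ 2))) := by gcongr
    _ = 2 * (k * F₀ + 2 * A) * (Real.exp (-2 * x ^ 2 / z₀ ^ 2) * (1 + x ^ 2)) := by ring
    _ ≤ 2 * (k * F₀ + 2 * A) * (1 + z₀ ^ 2 / 2) := by
        gcongr
        exact gaussian_mul_one_add_sq_le hz₀ x
    _ = _ := by rw [hA]; ring

/-- A periodic solution enters a fixed bounded region, by Rolle's theorem applied to
`G(z) - (A / b) z sin (2kz - bt)`, where `G` is an antiderivative of `1 / f` and `A = 2F₀ / z₀²`. -/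
theorem exists_abs_le_of_periodic_gaussian {F₀ k b z₀ T M : ℝ}
    (hF₀ : 0 < F₀) (hk : 0 < k) (hb : 0 < b)
    (hT : T = 4 * Real.pi / b) {z : ℝ → ℝ}
    (hM : ∀ t, |Fz F₀ k b (fun w => Real.exp (-2 * w ^ 2 / z₀ ^ 2)) t (z t)| * (1 + |z t|) ≤ M)
    (hz : ∀ t ∈ Icc 0 T, HasDerivWithinAt z
      (Fz F₀ k b (fun w => Real.exp (-2 * w ^ 2 / z₀ ^ 2)) t (z t)) (Icc 0 T) t)
    (hper : z 0 = z T) :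
    ∃ t ∈ Icc 0 T, 2 * F₀ / z₀ ^ 2 * |z t| ≤
      k * F₀ + 2 * F₀ / z₀ ^ 2 / b * (1 + 2 * k) * M := by
  set A := 2 * F₀ / z₀ ^ 2
  have hA0 : 0 ≤ A := by positivity
  have hT0 : 0 < T := by rw [hT]; positivity
  have hbT : b * T = 4 * Real.pi := by rw [hT]; field_simp
  set Z : ℝ → ℝ := fun t => Fz F₀ k b (fun w => Real.exp (-2 * w ^ 2 / z₀ ^ 2)) t (z t) with hZ
  let G : ℝ → ℝ := fun x => ∫ y in (0 : ℝ)..x, Real.exp (2 * y ^ 2 / z₀ ^ 2)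
  have hG : ∀ x, HasDerivAt G (Real.exp (2 * x ^ 2 / z₀ ^ 2)) x := fun x =>
    (Continuous.integral_hasStrictDerivAt (by fun_prop) 0 x).hasDerivAt
  let θ : ℝ → ℝ := fun t => 2 * k * z t - b * t
  let H : ℝ → ℝ := fun t => G (z t) - A / b * (z t * Real.sin (θ t))
  let H' : ℝ → ℝ := fun t => Real.exp (2 * (z t) ^ 2 / z₀ ^ 2) * Z t
    - A / b * (Z t * Real.sin (θ t) + z t * (Real.cos (θ t) * (2 * k * Z t - b)))
  have hH : ∀ t ∈ Icc 0 T, HasDerivWithinAt H (H' t) (Icc 0 T) t := by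
    intro t ht
    have hθ : HasDerivWithinAt θ (2 * k * Z t - b) (Icc 0 T) t :=
      (((hz t ht).const_mul (2 * k)).sub ((hasDerivWithinAt_id t _).const_mul b)).congr_deriv
        (by rw [mul_one])
    exact ((hG (z t)).comp_hasDerivWithinAt t (hz t ht)).sub
      (((hz t ht).mul hθ.sin).const_mul (A / b))
  have hHper : H 0 = H T := by
    have h0 : Real.sin (θ T) = Real.sin (θ 0) := by
      simp only [θ, hper, hbT]
      rw [show 2 * k * z T - 4 * Real.pi = 2 * k * z T - (2 : ℕ) * (2 * Real.pi) by
        push_cast; ring, Real.sin_sub_nat_mul_two_pi]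
      simp
    simp only [H, h0, hper]
  obtain ⟨t, ht, hroot⟩ := exists_hasDerivAt_eq_zero hT0
    (fun t ht => (hH t ht).continuousWithinAt) hHper
    (fun t ht => (hH t (Ioo_subset_Icc_self ht)).hasDerivAt (Icc_mem_nhds ht.1 ht.2))
  refine ⟨t, Ioo_subset_Icc_self ht, ?_⟩
  have hEZ : Real.exp (2 * (z t) ^ 2 / z₀ ^ 2) * Z t =
      -(k * F₀ * Real.sin (θ t)) - A * z t * (1 + Real.cos (θ t)) := by
    simp only [hZ, Fz_gaussian]
    rw [← mul_assoc, ← Real.exp_add,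
      show 2 * z t ^ 2 / z₀ ^ 2 + -2 * z t ^ 2 / z₀ ^ 2 = 0 by ring, Real.exp_zero, one_mul]
  have hkey : A * z t = -(k * F₀ * Real.sin (θ t))
      - A / b * (Z t * Real.sin (θ t) + 2 * k * (z t * Z t * Real.cos (θ t))) := by
    simp only [H', hEZ] at hroot
    have hAb : A / b * b = A := div_mul_cancel₀ _ hb.ne'
    linear_combination -hroot + z t * Real.cos (θ t) * hAb
  have hs := Real.abs_sin_le_one (θ t)
  have hc := Real.abs_cos_le_one (θ t)
  have hMt : |Z t| + |z t| * |Z t| ≤ M := by linarith [hM t]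
  have hkF : 0 < k * F₀ := by positivity
  have hzZ : 0 ≤ |z t| * |Z t| := by positivity
  have h1 : |Z t * Real.sin (θ t)| ≤ M := by
    rw [abs_mul]
    linarith [mul_le_of_le_one_right (abs_nonneg (Z t)) hs]
  have h2 : |z t * Z t * Real.cos (θ t)| ≤ M := by
    rw [abs_mul, abs_mul]
    linarith [mul_le_of_le_one_right hzZ hc, abs_nonneg (Z t)]
  have h3 : |Z t * Real.sin (θ t) + 2 * k * (z t * Z t * Real.cos (θ t))| ≤ M + 2 * k * M := by
    refine (abs_add_le _ _).trans (add_le_add h1 ?_)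
    rw [abs_mul (2 * k), abs_of_pos (by positivity : 0 < 2 * k)]
    gcongr
  calc A * |z t| = |A * z t| := by rw [abs_mul, abs_of_nonneg hA0]
    _ ≤ k * F₀ + A / b * (M + 2 * k * M) := by
        rw [hkey]
        refine (abs_sub _ _).trans (add_le_add ?_ ?_)
        · rw [abs_neg, abs_mul (k * F₀), abs_of_pos hkF]
          exact mul_le_of_le_one_right hkF.le hs
        · rw [abs_mul (A / b), abs_of_nonneg (by positivity : 0 ≤ A / b)]
          gcongr
    _ = _ := by ring

/-- The set of `T`-periodic solutions of `z' = F_z(t,z)` is bounded in the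
Gaussian case `f(z) = exp(−2z²/z₀²)`. -/
theorem bounded_periodic_solutions_gaussian
    (F₀ k b z₀ : ℝ) (hF₀ : 0 < F₀) (hk : 0 < k) (hb : 0 < b) (hz₀ : 0 < z₀)
    (T : ℝ) (hT : T = 4 * Real.pi / b)
    (f : ℝ → ℝ) (hf : f = fun w => Real.exp (-2 * w ^ 2 / z₀ ^ 2)) :
    ∃ D > 0, ∀ z : ℝ → ℝ,
      (∀ t ∈ Set.Icc 0 T, HasDerivWithinAt z (Fz F₀ k b f t (z t)) (Set.Icc 0 T) t) →
      z 0 = z T →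
      ∀ t ∈ Set.Icc 0 T, |z t| ≤ D := by
  subst hf
  set A := 2 * F₀ / z₀ ^ 2
  set M := 2 * (k * F₀ + 4 * F₀ / z₀ ^ 2) * (1 + z₀ ^ 2 / 2)
  have hA0 : 0 < A := by positivity
  have hM0 : 0 < M := by positivity
  have hT0 : 0 < T := by rw [hT]; positivity
  refine ⟨(k * F₀ + A / b * (1 + 2 * k) * M) / A + M * T, by positivity, ?_⟩
  intro z hz hper t ht
  have hbound := fun s => abs_Fz_gaussian_le hF₀ hk hz₀ b s (z s)
  obtain ⟨s, hs, hsle⟩ := exists_abs_le_of_periodic_gaussian hF₀ hk hb hT hbound hz hper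
  have hzs : |z s| ≤ (k * F₀ + A / b * (1 + 2 * k) * M) / A := by
    rw [le_div_iff₀ hA0, mul_comm]
    exact hsle
  have hlip : |z t - z s| ≤ M * |t - s| := by
    refine (convex_Icc 0 T).norm_image_sub_le_of_norm_hasDerivWithin_le hz (fun r _ => ?_) hs ht
    exact (le_mul_of_one_le_right (abs_nonneg _)
      (le_add_of_nonneg_right (abs_nonneg (z r)))).trans (hbound r)
  have hts : |t - s| ≤ T := by
    rw [abs_le]
    constructor <;> linarith [hs.1, hs.2, ht.1, ht.2]
  have htri : |z t| ≤ |z s| + |z t - z s| := by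
    simpa using abs_add_le (z s) (z t - z s)
  linarith [mul_le_mul_of_nonneg_left hts hM0.le]
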